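/- arXiv:1701.02076 — 2 statements merged into one kernel-verified Lean document; each statement's English description precedes it below -/
import Mathlib

section
/- For every n ≥ 2: (a) there exists a ℤ-algebra automorphism of H(S_n) sending s_i ↦ −s_i and D_i ↦ 1 − D_i for all i; (b) there exists a ℤ-algebra automorphism of H(S_n) sending s_i ↦ −s_i and D_i ↦ s_i + D_i for all i; (c) there exists a ℤ-algebra anti-automorphism of H(S_n) (a bijective additive map φ with φ(1)=1 and φ(xy)=φ(y)φ(x)) sending s_i ↦ s_i and D_i ↦ D_i for all i. -/
open scoped TensorProduct

namespace HeckeHopfSn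

/-- Generators of the Hecke-Hopf algebra `H(Sₙ)`: `s i` and `D i` for `i = 1, …, n-1`. -/
inductive Gen (n : ℕ) : Type
  | s : Fin (n - 1) → Gen n
  | D : Fin (n - 1) → Gen n

/-- The free `ℤ`-algebra on the generators. -/
abbrev F (n : ℕ) : Type := FreeAlgebra ℤ (Gen n)

noncomputable def fs (n : ℕ) (i : Fin (n - 1)) : F n := FreeAlgebra.ι ℤ (Gen.s i)
noncomputable def fD (n : ℕ) (i : Fin (n - 1)) : F n := FreeAlgebra.ι ℤ (Gen.D i)

/-- `|i - j| = 1`. -/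
def Adj (n : ℕ) (i j : Fin (n - 1)) : Prop := (i : ℕ) + 1 = (j : ℕ) ∨ (j : ℕ) + 1 = (i : ℕ)

/-- `|i - j| > 1`. -/
def Dist (n : ℕ) (i j : Fin (n - 1)) : Prop := (i : ℕ) + 1 < (j : ℕ) ∨ (j : ℕ) + 1 < (i : ℕ)

/-- The defining relations of `H(Sₙ)`. -/
inductive Rel (n : ℕ) : F n → F n → Prop
  | s_sq (i : Fin (n - 1)) : Rel n (fs n i * fs n i) 1
  | sD (i : Fin (n - 1)) : Rel n (fs n i * fD n i + fD n i * fs n i) (fs n i - 1)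
  | D_sq (i : Fin (n - 1)) : Rel n (fD n i * fD n i) (fD n i)
  | ss (i j : Fin (n - 1)) : Dist n i j → Rel n (fs n j * fs n i) (fs n i * fs n j)
  | Ds (i j : Fin (n - 1)) : Dist n i j → Rel n (fD n j * fs n i) (fs n i * fD n j)
  | DD (i j : Fin (n - 1)) : Dist n i j → Rel n (fD n j * fD n i) (fD n i * fD n j)
  | braid (i j : Fin (n - 1)) : Adj n i j →
      Rel n (fs n j * fs n i * fs n j) (fs n i * fs n j * fs n i)
  | braidDs (i j : Fin (n - 1)) : Adj n i j →
      Rel n (fD n i * fs n j * fs n i) (fs n j * fs n i * fD n j)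
  | braidDsD (i j : Fin (n - 1)) : Adj n i j →
      Rel n (fD n j * fs n i * fD n j)
        (fs n i * fD n j * fD n i + fD n i * fD n j * fs n i + fs n i * fD n j * fs n i)

/-- The Hecke-Hopf algebra `H(Sₙ)` of the symmetric group `Sₙ`. -/
abbrev HH (n : ℕ) : Type := RingQuot (Rel n)

/-- The image of the generator `sᵢ` in `H(Sₙ)`. -/
noncomputable def sg (n : ℕ) (i : Fin (n - 1)) : HH n := RingQuot.mkAlgHom ℤ (Rel n) (fs n i)

/-- The image of the generator `Dᵢ` in `H(Sₙ)`. -/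
noncomputable def dg (n : ℕ) (i : Fin (n - 1)) : HH n := RingQuot.mkAlgHom ℤ (Rel n) (fD n i)

section Symmetries

variable {n : ℕ}

section Relations

variable (i j : Fin (n - 1))

theorem sg_mul_sg_self : sg n i * sg n i = 1 := by
  simpa [sg] using RingQuot.mkAlgHom_rel ℤ (Rel.s_sq i)

theorem sg_mul_dg_add_dg_mul_sg : sg n i * dg n i + dg n i * sg n i = sg n i - 1 := by
  simpa [sg, dg] using RingQuot.mkAlgHom_rel ℤ (Rel.sD i)

theorem dg_mul_dg_self : dg n i * dg n i = dg n i := by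
  simpa [dg] using RingQuot.mkAlgHom_rel ℤ (Rel.D_sq i)

variable {i j}

theorem Adj.symm (h : Adj n i j) : Adj n j i := Or.symm h

theorem Dist.symm (h : Dist n i j) : Dist n j i := Or.symm h

theorem sg_mul_sg_of_dist (h : Dist n i j) : sg n j * sg n i = sg n i * sg n j := by
  simpa [sg] using RingQuot.mkAlgHom_rel ℤ (Rel.ss i j h)

theorem dg_mul_sg_of_dist (h : Dist n i j) : dg n j * sg n i = sg n i * dg n j := by
  simpa [sg, dg] using RingQuot.mkAlgHom_rel ℤ (Rel.Ds i j h)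

theorem dg_mul_dg_of_dist (h : Dist n i j) : dg n j * dg n i = dg n i * dg n j := by
  simpa [dg] using RingQuot.mkAlgHom_rel ℤ (Rel.DD i j h)

theorem sg_mul_sg_mul_sg_of_adj (h : Adj n i j) :
    sg n j * sg n i * sg n j = sg n i * sg n j * sg n i := by
  simpa [sg] using RingQuot.mkAlgHom_rel ℤ (Rel.braid i j h)

theorem dg_mul_sg_mul_sg_of_adj (h : Adj n i j) :
    dg n i * sg n j * sg n i = sg n j * sg n i * dg n j := by
  simpa [sg, dg] using RingQuot.mkAlgHom_rel ℤ (Rel.braidDs i j h)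

theorem dg_mul_sg_mul_dg_of_adj (h : Adj n i j) :
    dg n j * sg n i * dg n j =
      sg n i * dg n j * dg n i + dg n i * dg n j * sg n i + sg n i * dg n j * sg n i := by
  simpa [sg, dg] using RingQuot.mkAlgHom_rel ℤ (Rel.braidDsD i j h)

end Relations

section UniversalProperty

variable {A : Type*} [Ring A] [Algebra ℤ A]

/-- The algebra homomorphism on the free algebra with prescribed values on the generators. -/
noncomputable def freeLift (S D : Fin (n - 1) → A) : F n →ₐ[ℤ] A :=
  FreeAlgebra.lift ℤ fun g => match g with
    | Gen.s i => S i
    | Gen.D i => D i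

@[simp]
theorem freeLift_fs (S D : Fin (n - 1) → A) (i : Fin (n - 1)) : freeLift S D (fs n i) = S i := by
  simp [freeLift, fs]

@[simp]
theorem freeLift_fD (S D : Fin (n - 1) → A) (i : Fin (n - 1)) : freeLift S D (fD n i) = D i := by
  simp [freeLift, fD]

theorem exists_algHom (S D : Fin (n - 1) → A)
    (h : ∀ ⦃x y : F n⦄, Rel n x y → freeLift S D x = freeLift S D y) :
    ∃ φ : HH n →ₐ[ℤ] A, (∀ i, φ (sg n i) = S i) ∧ ∀ i, φ (dg n i) = D i :=
  ⟨RingQuot.liftAlgHom ℤ ⟨freeLift S D, h⟩, fun i => by simp [sg], fun i => by simp [dg]⟩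

theorem algHom_ext {φ ψ : HH n →ₐ[ℤ] A} (hs : ∀ i, φ (sg n i) = ψ (sg n i))
    (hD : ∀ i, φ (dg n i) = ψ (dg n i)) : φ = ψ := by
  refine RingQuot.ringQuot_ext' ℤ _ _ (FreeAlgebra.hom_ext (funext ?_))
  rintro (i | i)
  exacts [hs i, hD i]

end UniversalProperty

theorem exists_algEquiv_of_involutive (S D : Fin (n - 1) → HH n) (φ : HH n →ₐ[ℤ] HH n)
    (hs : ∀ i, φ (sg n i) = S i) (hD : ∀ i, φ (dg n i) = D i)
    (hS' : ∀ i, φ (S i) = sg n i) (hD' : ∀ i, φ (D i) = dg n i) :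
    ∃ ψ : HH n ≃ₐ[ℤ] HH n, (∀ i, ψ (sg n i) = S i) ∧ ∀ i, ψ (dg n i) = D i := by
  have h : φ.comp φ = AlgHom.id ℤ (HH n) :=
    algHom_ext (fun i => by simp [hs, hS']) (fun i => by simp [hD, hD'])
  exact ⟨AlgEquiv.ofAlgHom φ φ h h, hs, hD⟩

theorem exists_algEquiv_neg_one_sub :
    ∃ φ : HH n ≃ₐ[ℤ] HH n,
      (∀ i, φ (sg n i) = -(sg n i)) ∧ ∀ i, φ (dg n i) = 1 - dg n i := by
  obtain ⟨φ, hs, hD⟩ := exists_algHom (fun i => -(sg n i)) (fun i => 1 - dg n i) (by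
    rintro _ _ (i | i | i | ⟨i, j, h⟩ | ⟨i, j, h⟩ | ⟨i, j, h⟩ | ⟨i, j, h⟩ | ⟨i, j, h⟩ | ⟨i, j, h⟩) <;>
      simp only [map_mul, map_add, map_sub, map_one, freeLift_fs, freeLift_fD]
    · linear_combination (norm := grind) sg_mul_sg_self i
    · linear_combination (norm := grind) sg_mul_dg_add_dg_mul_sg i
    · linear_combination (norm := grind) dg_mul_dg_self i
    · linear_combination (norm := grind) sg_mul_sg_of_dist h
    · linear_combination (norm := grind) dg_mul_sg_of_dist h
    · linear_combination (norm := grind) dg_mul_dg_of_dist h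
    · linear_combination (norm := grind) -sg_mul_sg_mul_sg_of_adj h
    · linear_combination (norm := grind) -dg_mul_sg_mul_sg_of_adj h
    · linear_combination (norm := grind) -dg_mul_sg_mul_dg_of_adj h
        - sg_mul_dg_add_dg_mul_sg i - sg_mul_sg_self i)
  exact exists_algEquiv_of_involutive _ _ φ hs hD (by simp [hs]) (by simp [hD])

theorem exists_algEquiv_neg_add :
    ∃ φ : HH n ≃ₐ[ℤ] HH n,
      (∀ i, φ (sg n i) = -(sg n i)) ∧ ∀ i, φ (dg n i) = sg n i + dg n i := by
  obtain ⟨φ, hs, hD⟩ := exists_algHom (fun i => -(sg n i)) (fun i => sg n i + dg n i) (by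
    rintro _ _ (i | i | i | ⟨i, j, h⟩ | ⟨i, j, h⟩ | ⟨i, j, h⟩ | ⟨i, j, h⟩ | ⟨i, j, h⟩ | ⟨i, j, h⟩) <;>
      simp only [map_mul, map_add, map_sub, map_one, freeLift_fs, freeLift_fD]
    · linear_combination (norm := grind) sg_mul_sg_self i
    · linear_combination (norm := grind)
        -sg_mul_dg_add_dg_mul_sg i - (2 : ℤ) • sg_mul_sg_self i
    · linear_combination (norm := grind)
        sg_mul_sg_self i + sg_mul_dg_add_dg_mul_sg i + dg_mul_dg_self i
    · linear_combination (norm := grind) sg_mul_sg_of_dist h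
    · linear_combination (norm := grind) -sg_mul_sg_of_dist h - dg_mul_sg_of_dist h
    · linear_combination (norm := grind) sg_mul_sg_of_dist h + dg_mul_sg_of_dist h
        - dg_mul_sg_of_dist h.symm + dg_mul_dg_of_dist h
    · linear_combination (norm := grind) -sg_mul_sg_mul_sg_of_adj h
    · linear_combination (norm := grind)
        dg_mul_sg_mul_sg_of_adj h - sg_mul_sg_mul_sg_of_adj h
    · linear_combination (norm := grind) -dg_mul_sg_mul_dg_of_adj h
        - sg_mul_sg_mul_sg_of_adj h + dg_mul_sg_mul_sg_of_adj h
        - dg_mul_sg_mul_sg_of_adj h.symm)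
  exact exists_algEquiv_of_involutive _ _ φ hs hD (by simp [hs]) (by simp [hs, hD])

open MulOpposite in
theorem exists_antiAutomorphism :
    ∃ φ : HH n ≃+ HH n,
      φ 1 = 1 ∧ (∀ x y : HH n, φ (x * y) = φ y * φ x) ∧
      (∀ i, φ (sg n i) = sg n i) ∧ ∀ i, φ (dg n i) = dg n i := by
  obtain ⟨φ, hs, hD⟩ := exists_algHom (fun i => op (sg n i)) (fun i => op (dg n i)) (by
    rintro _ _ (i | i | i | ⟨i, j, h⟩ | ⟨i, j, h⟩ | ⟨i, j, h⟩ | ⟨i, j, h⟩ | ⟨i, j, h⟩ | ⟨i, j, h⟩) <;>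
      simp only [map_mul, map_add, map_sub, map_one, freeLift_fs, freeLift_fD] <;>
      apply unop_injective <;>
      simp only [unop_mul, unop_add, unop_sub, unop_one, unop_op]
    · exact sg_mul_sg_self i
    · linear_combination (norm := grind) sg_mul_dg_add_dg_mul_sg i
    · exact dg_mul_dg_self i
    · exact (sg_mul_sg_of_dist h).symm
    · exact (dg_mul_sg_of_dist h).symm
    · exact (dg_mul_dg_of_dist h).symm
    · linear_combination (norm := grind) sg_mul_sg_mul_sg_of_adj h
    · linear_combination (norm := grind) -dg_mul_sg_mul_sg_of_adj h.symm
    · linear_combination (norm := grind) dg_mul_sg_mul_dg_of_adj h)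
  have hcomp : ((AlgEquiv.opOp ℤ (HH n)).symm : _ →ₐ[ℤ] HH n).comp ((AlgHom.op φ).comp φ) =
      AlgHom.id ℤ (HH n) :=
    algHom_ext (fun i => by simp [hs]) (fun i => by simp [hD])
  have hinv : ∀ x, unop (φ (unop (φ x))) = x := fun x => DFunLike.congr_fun hcomp x
  exact ⟨{ toFun := fun x => unop (φ x)
           invFun := fun x => unop (φ x)
           left_inv := hinv
           right_inv := hinv
           map_add' := by simp }, by simp, by simp, by simp [hs], by simp [hD]⟩

end Symmetries

/-- Symmetries of `H(Sₙ)`: (a) an algebra automorphism with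
`sᵢ ↦ -sᵢ`, `Dᵢ ↦ 1 - Dᵢ`; (b) an algebra automorphism with `sᵢ ↦ -sᵢ`, `Dᵢ ↦ sᵢ + Dᵢ`;
(c) an algebra anti-automorphism fixing all `sᵢ` and `Dᵢ`. -/
theorem symmetries_of_HH (n : ℕ) (hn : 2 ≤ n) :
    (∃ φ : HH n ≃ₐ[ℤ] HH n,
      (∀ i : Fin (n - 1), φ (sg n i) = -(sg n i)) ∧
      (∀ i : Fin (n - 1), φ (dg n i) = 1 - dg n i)) ∧
    (∃ φ : HH n ≃ₐ[ℤ] HH n,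
      (∀ i : Fin (n - 1), φ (sg n i) = -(sg n i)) ∧
      (∀ i : Fin (n - 1), φ (dg n i) = sg n i + dg n i)) ∧
    (∃ φ : HH n ≃+ HH n,
      φ 1 = 1 ∧ (∀ x y : HH n, φ (x * y) = φ y * φ x) ∧
      (∀ i : Fin (n - 1), φ (sg n i) = sg n i) ∧
      (∀ i : Fin (n - 1), φ (dg n i) = dg n i)) :=
  ⟨exists_algEquiv_neg_one_sub, exists_algEquiv_neg_add, exists_antiAutomorphism⟩

end HeckeHopfSn
end

section
/- For every n ≥ 2, H(S_n) factors as D(S_n)·ℤS_n over ℤ: the ℤ-linear map D(S_n) ⊗_ℤ ℤ[S_n] → H(S_n) sending d ⊗ w to d·π(w) is a bijection (an isomorphism of ℤ-modules), where ℤ[S_n] is the group algebra of S_n over ℤ. -/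
open scoped TensorProduct

namespace HeckeHopfSn

/-- The element `i` of `{1, …, n}`, for `i ∈ {1, …, n-1}`. -/
def finA (n : ℕ) (i : Fin (n - 1)) : Fin n := ⟨(i : ℕ), by have h := i.2; omega⟩

/-- The element `i + 1` of `{1, …, n}`, for `i ∈ {1, …, n-1}`. -/
def finB (n : ℕ) (i : Fin (n - 1)) : Fin n := ⟨(i : ℕ) + 1, by have h := i.2; omega⟩

/-- Pairs `(i, j)` with `1 ≤ i < j ≤ n`. -/
def PairLT (n : ℕ) : Type := {p : Fin n × Fin n // p.1 < p.2}

/-- The pair `(i, i+1)`. -/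
def pairOf (n : ℕ) (i : Fin (n - 1)) : PairLT n :=
  ⟨(finA n i, finB n i), by simp [finA, finB, Fin.lt_def]⟩

/-- The relations of the algebra `PairAlg α`: a presentation, equivariant under `Perm α`, of the
algebra generated by the `D_{ij}`, in which `E_{ij} = D_{ij}` and `E_{ji} = 1 - D_{ij}` for
`i < j`. -/
inductive PairRel (α : Type*) :
    FreeAlgebra ℤ (α × α) → FreeAlgebra ℤ (α × α) → Prop
  | diag (a : α) : PairRel α (FreeAlgebra.ι ℤ (a, a)) 0
  | compl (a b : α) : a ≠ b →
      PairRel α (FreeAlgebra.ι ℤ (a, b) + FreeAlgebra.ι ℤ (b, a)) 1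
  | idem (a b : α) :
      PairRel α (FreeAlgebra.ι ℤ (a, b) * FreeAlgebra.ι ℤ (a, b)) (FreeAlgebra.ι ℤ (a, b))
  | comm (a b c d : α) : a ≠ c → a ≠ d → b ≠ c → b ≠ d →
      PairRel α (FreeAlgebra.ι ℤ (a, b) * FreeAlgebra.ι ℤ (c, d))
        (FreeAlgebra.ι ℤ (c, d) * FreeAlgebra.ι ℤ (a, b))
  | cyc (a b c : α) : a ≠ b → b ≠ c → a ≠ c →
      PairRel α (FreeAlgebra.ι ℤ (a, b) * FreeAlgebra.ι ℤ (b, c) +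
          FreeAlgebra.ι ℤ (b, c) * FreeAlgebra.ι ℤ (c, a) +
          FreeAlgebra.ι ℤ (c, a) * FreeAlgebra.ι ℤ (a, b))
        (FreeAlgebra.ι ℤ (a, b) + FreeAlgebra.ι ℤ (b, c) + FreeAlgebra.ι ℤ (c, a) - 1)

/-- The algebra presented by the generators `E_{ab}` and the relations `PairRel`. -/
def PairAlg (α : Type*) : Type _ := RingQuot (PairRel α)

noncomputable instance (α : Type*) : Ring (PairAlg α) :=
  inferInstanceAs (Ring (RingQuot (PairRel α)))

section PairAlg

variable {α : Type*}

/-- The canonical projection. -/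
noncomputable def PairAlg.mk (α : Type*) : FreeAlgebra ℤ (α × α) →+* PairAlg α :=
  RingQuot.mkRingHom (PairRel α)

lemma PairAlg.mk_rel {x y : FreeAlgebra ℤ (α × α)} (h : PairRel α x y) :
    PairAlg.mk α x = PairAlg.mk α y :=
  RingQuot.mkRingHom_rel h

/-- The generator `E_{ab}`. -/
noncomputable def E (a b : α) : PairAlg α := PairAlg.mk α (FreeAlgebra.ι ℤ (a, b))

lemma E_self (a : α) : E a a = 0 := by
  simpa [E] using PairAlg.mk_rel (PairRel.diag a)

lemma E_add_E {a b : α} (h : a ≠ b) : E a b + E b a = 1 := by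
  simpa [E] using PairAlg.mk_rel (PairRel.compl a b h)

lemma E_mul_self (a b : α) : E a b * E a b = E a b := by
  simpa [E] using PairAlg.mk_rel (PairRel.idem a b)

lemma E_comm {a b c d : α} (h₁ : a ≠ c) (h₂ : a ≠ d) (h₃ : b ≠ c) (h₄ : b ≠ d) :
    E a b * E c d = E c d * E a b := by
  simpa [E] using PairAlg.mk_rel (PairRel.comm a b c d h₁ h₂ h₃ h₄)

lemma E_cyc {a b c : α} (h₁ : a ≠ b) (h₂ : b ≠ c) (h₃ : a ≠ c) :
    E a b * E b c + E b c * E c a + E c a * E a b = E a b + E b c + E c a - 1 := by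
  simpa [E] using PairAlg.mk_rel (PairRel.cyc a b c h₁ h₂ h₃)

lemma E_mul_E {x y z : α} (hxy : x ≠ y) (hyz : y ≠ z) (hxz : x ≠ z) :
    E x y * E y z = E x z * E x y + E y z * E x z - E x z := by
  have h := E_cyc hxy hyz hxz
  rw [← sub_eq_of_eq_add' (E_add_E hxz).symm] at h
  rw [← sub_eq_zero] at h ⊢
  rw [← h]
  noncomm_ring

lemma E_mul_E' {x y z : α} (hxy : x ≠ y) (hyz : y ≠ z) (hxz : x ≠ z) :
    E y z * E x y = E x y * E x z + E x z * E y z - E x z := by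
  have h := E_cyc hyz.symm hxy.symm hxz.symm
  rw [← sub_eq_of_eq_add' (E_add_E hxy).symm, ← sub_eq_of_eq_add' (E_add_E hyz).symm] at h
  rw [← sub_eq_zero] at h ⊢
  rw [← h]
  noncomm_ring

/-- The universal property of `PairAlg α`. -/
noncomputable def pairLift {A : Type*} [Ring A] (e : α → α → A)
    (diag : ∀ a, e a a = 0) (compl : ∀ a b, a ≠ b → e a b + e b a = 1)
    (idem : ∀ a b, e a b * e a b = e a b)
    (comm : ∀ a b c d, a ≠ c → a ≠ d → b ≠ c → b ≠ d → e a b * e c d = e c d * e a b)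
    (cyc : ∀ a b c, a ≠ b → b ≠ c → a ≠ c →
      e a b * e b c + e b c * e c a + e c a * e a b = e a b + e b c + e c a - 1) :
    PairAlg α →+* A :=
  RingQuot.lift ⟨(FreeAlgebra.lift ℤ fun p => e p.1 p.2).toRingHom, by
    rintro _ _ (a | ⟨a, b, h⟩ | ⟨a, b⟩ | ⟨a, b, c, d, h₁, h₂, h₃, h₄⟩ | ⟨a, b, c, h₁, h₂, h₃⟩)
    · simpa using diag a
    · simpa using compl a b h
    · simpa using idem a b
    · simpa using comm a b c d h₁ h₂ h₃ h₄
    · simpa using cyc a b c h₁ h₂ h₃⟩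

lemma pairLift_E {A : Type*} [Ring A] (e : α → α → A) (diag compl idem comm cyc)
    (a b : α) : pairLift e diag compl idem comm cyc (E a b) = e a b :=
  (RingQuot.lift_mkRingHom_apply _ _ _).trans (by simp)

@[elab_as_elim]
lemma PairAlg.induction {P : PairAlg α → Prop} (int : ∀ r : ℤ, P r)
    (gen : ∀ a b, P (E a b)) (add : ∀ x y, P x → P y → P (x + y))
    (mul : ∀ x y, P x → P y → P (x * y)) (d : PairAlg α) : P d := by
  obtain ⟨f, rfl⟩ := RingQuot.mkRingHom_surjective (PairRel α) d
  change P (PairAlg.mk α f)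
  induction f using FreeAlgebra.induction with
  | grade0 r => simpa using int r
  | grade1 p => exact gen p.1 p.2
  | mul x y hx hy => simpa using mul _ _ hx hy
  | add x y hx hy => simpa using add _ _ hx hy

/-- The left `PairAlg α`-module `PairAlg α ⊗ ℤ[Perm α]`, on which `H(Sₙ)` acts. -/
def PairMod (α : Type*) : Type _ := Equiv.Perm α →₀ PairAlg α

noncomputable instance : AddCommGroup (PairMod α) :=
  inferInstanceAs (AddCommGroup (Equiv.Perm α →₀ PairAlg α))

noncomputable instance : Module (PairAlg α) (PairMod α) :=
  inferInstanceAs (Module (PairAlg α) (Equiv.Perm α →₀ PairAlg α))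

/-- The element `d ⊗ w`. -/
noncomputable def basisElt (w : Equiv.Perm α) : PairAlg α →+ PairMod α :=
  Finsupp.singleAddHom w

/-- Additive maps out of `PairMod α`. -/
noncomputable def liftMod {A : Type*} [AddCommMonoid A] (f : Equiv.Perm α → PairAlg α →+ A) :
    PairMod α →+ A :=
  Finsupp.liftAddHom f

lemma liftMod_basisElt {A : Type*} [AddCommMonoid A] (f : Equiv.Perm α → PairAlg α →+ A)
    (w : Equiv.Perm α) (d : PairAlg α) : liftMod f (basisElt w d) = f w d :=
  Finsupp.liftAddHom_apply_single ..

lemma PairMod.hom_ext {A : Type*} [AddCommMonoid A] {f g : PairMod α →+ A}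
    (h : ∀ w d, f (basisElt w d) = g (basisElt w d)) : f = g :=
  Finsupp.addHom_ext h

lemma smul_basisElt (d e : PairAlg α) (w : Equiv.Perm α) :
    d • basisElt w e = basisElt w (d * e) :=
  Finsupp.smul_single ..

lemma end_mul_apply {M : Type*} [AddCommMonoid M] (f g : AddMonoid.End M) (m : M) :
    (f * g) m = f (g m) := rfl

lemma end_add_apply {M : Type*} [AddCommMonoid M] (f g : AddMonoid.End M) (m : M) :
    (f + g) m = f m + g m := rfl

/-- Left multiplication by `PairAlg α`. -/
noncomputable def opL : PairAlg α →+* AddMonoid.End (PairMod α) :=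
  Module.toAddMonoidEnd (PairAlg α) (PairMod α)

lemma opL_single (d e : PairAlg α) (w : Equiv.Perm α) :
    opL d (basisElt w e) = basisElt w (d * e) :=
  smul_basisElt ..

/-- Endomorphisms that agree on the basis elements `w` and whose difference permutes the `E_{ab}`
are equal. -/
lemma eq_of_intertwine {f g : AddMonoid.End (PairMod α)}
    (h₁ : ∀ w : Equiv.Perm α, f (basisElt w 1) = g (basisElt w 1))
    (h : ∀ a b, ∃ d, (f - g) * opL (E a b) = d * (f - g)) : f = g := by
  have key : ∀ d m, (f - g) m = 0 → (f - g) (opL d m) = 0 := by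
    intro d
    induction d using PairAlg.induction with
    | int r =>
      intro m hm
      rw [map_intCast, AddMonoid.End.intCast_apply, map_zsmul, hm, smul_zero]
    | gen a b =>
      intro m hm
      obtain ⟨d, hd⟩ := h a b
      rw [← end_mul_apply, hd, end_mul_apply, hm, map_zero]
    | add d e hd he =>
      intro m hm
      rw [map_add, end_add_apply, map_add, hd m hm, he m hm, add_zero]
    | mul d e hd he =>
      intro m hm
      rw [map_mul, end_mul_apply]
      exact hd _ (he m hm)
  refine PairMod.hom_ext fun w d => ?_
  have := key d (basisElt w 1) (sub_eq_zero.2 (h₁ w))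
  rw [opL_single, mul_one] at this
  exact sub_eq_zero.1 this

variable [DecidableEq α]

/-- The coefficient `c` in the relation `s · E_{ab} = E_{s(a)s(b)} · s + c`, for `s = (x y)`. -/
def coef (x y a b : α) : ℤ :=
  if a = y ∧ b = x then 1 else if a = x ∧ b = y then -1 else 0

lemma coef_cases (x y a b : α) :
    (a = y ∧ b = x) ∨ (a = x ∧ b = y) ∨ coef x y a b = 0 := by
  unfold coef; grind

lemma coef_map (w : Equiv.Perm α) (x y a b : α) :
    coef (w x) (w y) (w a) (w b) = coef x y a b := by
  simp [coef]

lemma coef_mul_E_swap {x y a b c d : α} (h₁ : a ≠ c) (h₂ : a ≠ d) (h₃ : b ≠ c) (h₄ : b ≠ d) :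
    E (Equiv.swap x y a) (Equiv.swap x y b) * (coef x y c d : PairAlg α) =
      coef x y c d * E a b := by
  rw [(Int.cast_commute _ _).eq]
  rcases coef_cases x y c d with ⟨rfl, rfl⟩ | ⟨rfl, rfl⟩ | h
  · rw [Equiv.swap_apply_of_ne_of_ne h₂ h₁, Equiv.swap_apply_of_ne_of_ne h₄ h₃]
  · rw [Equiv.swap_apply_of_ne_of_ne h₁ h₂, Equiv.swap_apply_of_ne_of_ne h₃ h₄]
  · simp [h]

lemma coef_mul_E_add {x y a b c : α} (h₂ : b ≠ c) (h₃ : a ≠ c) :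
    coef x y a b * E b c + E (Equiv.swap x y c) (Equiv.swap x y a) * (coef x y a b : PairAlg α) =
      coef x y a b := by
  rw [← (Int.cast_commute _ (E _ _)).eq, ← mul_add]
  rcases coef_cases x y a b with ⟨rfl, rfl⟩ | ⟨rfl, rfl⟩ | h
  · rw [Equiv.swap_apply_of_ne_of_ne h₂.symm h₃.symm, Equiv.swap_apply_right, E_add_E h₂, mul_one]
  · rw [Equiv.swap_apply_of_ne_of_ne h₃.symm h₂.symm, Equiv.swap_apply_left, E_add_E h₂, mul_one]
  · simp [h]

/-- The ring homomorphism `d ↦ !![σ d, ∂ d; 0, d]` encoding `s · d = σ(d) · s + ∂(d)`. -/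
noncomputable def twist {x y : α} (hxy : x ≠ y) :
    PairAlg α →+* Matrix (Fin 2) (Fin 2) (PairAlg α) :=
  pairLift (fun a b => !![E (Equiv.swap x y a) (Equiv.swap x y b), (coef x y a b : PairAlg α);
      0, E a b])
    (fun a => by
      have : coef x y a a = 0 := by unfold coef; grind
      ext i j; fin_cases i <;> fin_cases j <;> simp [E_self, this])
    (fun a b h => by
      have : coef x y a b + coef x y b a = 0 := by unfold coef; grind
      have h' : Equiv.swap x y a ≠ Equiv.swap x y b := by simpa using h
      ext i j; fin_cases i <;> fin_cases j <;>
        simp [E_add_E h, E_add_E h', ← Int.cast_add, this])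
    (fun a b => by
      ext i j; fin_cases i <;> fin_cases j <;> simp [E_mul_self]
      rw [(Int.cast_commute _ (E a b)).eq, ← add_mul]
      rcases coef_cases x y a b with ⟨rfl, rfl⟩ | ⟨rfl, rfl⟩ | h
      · simp [E_add_E hxy]
      · simp [E_add_E hxy.symm]
      · simp [h])
    (fun a b c d h₁ h₂ h₃ h₄ => by
      have k : ∀ {u v}, u ≠ v → Equiv.swap x y u ≠ Equiv.swap x y v := by simp
      ext i j; fin_cases i <;> fin_cases j <;>
        simp [E_comm h₁ h₂ h₃ h₄, E_comm (k h₁) (k h₂) (k h₃) (k h₄)]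
      rw [coef_mul_E_swap h₁ h₂ h₃ h₄, coef_mul_E_swap h₁.symm h₃.symm h₂.symm h₄.symm, add_comm])
    (fun a b c h₁ h₂ h₃ => by
      have k : ∀ {u v}, u ≠ v → Equiv.swap x y u ≠ Equiv.swap x y v := by simp
      ext i j; fin_cases i <;> fin_cases j <;>
        simp [E_cyc h₁ h₂ h₃, E_cyc (k h₁) (k h₂) (k h₃)]
      conv_rhs => rw [← coef_mul_E_add h₂ h₃, ← coef_mul_E_add h₃.symm h₁.symm,
        ← coef_mul_E_add h₁ h₂.symm]
      abel)

lemma twist_E {x y : α} (hxy : x ≠ y) (a b : α) :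
    twist hxy (E a b) =
      !![E (Equiv.swap x y a) (Equiv.swap x y b), (coef x y a b : PairAlg α); 0, E a b] :=
  pairLift_E ..

/-- The automorphism `σ`. -/
noncomputable def sigma {x y : α} (hxy : x ≠ y) : PairAlg α →+ PairAlg α :=
  AddMonoidHom.mk' (fun d => twist hxy d 0 0) (by simp)

/-- The twisted derivation `∂`. -/
noncomputable def del {x y : α} (hxy : x ≠ y) : PairAlg α →+ PairAlg α :=
  AddMonoidHom.mk' (fun d => twist hxy d 0 1) (by simp)

lemma sigma_apply {x y : α} (hxy : x ≠ y) (d : PairAlg α) : sigma hxy d = twist hxy d 0 0 := rfl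

lemma del_apply {x y : α} (hxy : x ≠ y) (d : PairAlg α) : del hxy d = twist hxy d 0 1 := rfl

lemma twist_one {x y : α} (hxy : x ≠ y) (d : PairAlg α) :
    twist hxy d 1 0 = 0 ∧ twist hxy d 1 1 = d := by
  induction d using PairAlg.induction with
  | int r => simp [Matrix.intCast_apply]
  | gen a b => simp [twist_E]
  | add d e hd he => simp [hd, he]
  | mul d e hd he => simp [Matrix.mul_apply, hd, he]

lemma sigma_mul {x y : α} (hxy : x ≠ y) (d e : PairAlg α) :
    sigma hxy (d * e) = sigma hxy d * sigma hxy e := by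
  simp [sigma_apply, Matrix.mul_apply, twist_one]

lemma del_mul {x y : α} (hxy : x ≠ y) (d e : PairAlg α) :
    del hxy (d * e) = sigma hxy d * del hxy e + del hxy d * e := by
  simp [sigma_apply, del_apply, Matrix.mul_apply, twist_one]

lemma sigma_E {x y : α} (hxy : x ≠ y) (a b : α) :
    sigma hxy (E a b) = E (Equiv.swap x y a) (Equiv.swap x y b) := by
  simp [sigma_apply, twist_E]

lemma del_E {x y : α} (hxy : x ≠ y) (a b : α) : del hxy (E a b) = coef x y a b := by
  simp [del_apply, twist_E]

lemma sigma_intCast {x y : α} (hxy : x ≠ y) (r : ℤ) : sigma hxy r = r := by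
  simp [sigma_apply, Matrix.intCast_apply]

lemma del_intCast {x y : α} (hxy : x ≠ y) (r : ℤ) : del hxy r = 0 := by
  simp [del_apply, Matrix.intCast_apply]

/-- The action of the transposition `(x y)`. -/
noncomputable def opS {x y : α} (hxy : x ≠ y) : AddMonoid.End (PairMod α) :=
  liftMod fun w =>
    (basisElt (Equiv.swap x y * w)).comp (sigma hxy) +
      (basisElt w).comp (del hxy)

lemma opS_single {x y : α} (hxy : x ≠ y) (d : PairAlg α) (w : Equiv.Perm α) :
    opS hxy (basisElt w d) =
      basisElt (Equiv.swap x y * w) (sigma hxy d) + basisElt w (del hxy d) :=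
  (liftMod_basisElt ..).trans (by simp)

lemma opS_single_one {x y : α} (hxy : x ≠ y) (w : Equiv.Perm α) :
    opS hxy (basisElt w 1) = basisElt (Equiv.swap x y * w) 1 := by
  have h₁ := sigma_intCast hxy 1
  have h₂ := del_intCast hxy 1
  rw [Int.cast_one] at h₁ h₂
  rw [opS_single, h₁, h₂, map_zero, add_zero]

lemma opS_mul_opL {x y : α} (hxy : x ≠ y) (a b : α) :
    opS hxy * opL (E a b) =
      opL (E (Equiv.swap x y a) (Equiv.swap x y b)) * opS hxy +
        (coef x y a b : AddMonoid.End (PairMod α)) := by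
  refine PairMod.hom_ext fun w d => ?_
  change opS hxy (opL (E a b) _) = opL _ (opS hxy _) + (coef x y a b : AddMonoid.End (PairMod α)) _
  rw [opL_single, opS_single, opS_single, map_add, opL_single, opL_single, sigma_mul, del_mul,
    sigma_E, del_E, AddMonoid.End.intCast_apply, map_add, ← zsmul_eq_mul, map_zsmul, add_assoc]

lemma coef_swap {x y : α} (hxy : x ≠ y) (a b : α) :
    coef x y (Equiv.swap x y a) (Equiv.swap x y b) = -coef x y a b := by
  rw [← coef_map (Equiv.swap x y)]
  simp only [Equiv.swap_apply_left, Equiv.swap_apply_right, Equiv.swap_apply_self]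
  unfold coef
  grind

lemma opS_sq {x y : α} (hxy : x ≠ y) : opS hxy * opS hxy = 1 := by
  refine eq_of_intertwine (fun w => ?_) fun a b => ⟨opL (E a b), ?_⟩
  · rw [end_mul_apply, opS_single_one, opS_single_one, ← mul_assoc,
      Equiv.swap_mul_self, one_mul]
    rfl
  · rw [sub_mul, mul_assoc, opS_mul_opL, mul_add, ← mul_assoc, opS_mul_opL, coef_swap hxy,
      ← (Int.cast_commute _ (opS hxy)).eq]
    simp only [Equiv.swap_apply_self, Int.cast_neg, neg_mul, one_mul, mul_sub, add_mul, mul_assoc,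
      mul_one]
    abel

lemma opS_comm {x y z u : α} (hxy : x ≠ y) (hzu : z ≠ u) (h₁ : x ≠ z) (h₂ : x ≠ u) (h₃ : y ≠ z)
    (h₄ : y ≠ u) : opS hxy * opS hzu = opS hzu * opS hxy := by
  have hs : Equiv.swap x y * Equiv.swap z u = Equiv.swap z u * Equiv.swap x y := by
    have : (Equiv.swap x y * Equiv.swap z u * (Equiv.swap x y)⁻¹) = Equiv.swap z u := by
      rw [← Equiv.swap_apply_apply, Equiv.swap_apply_of_ne_of_ne h₁.symm h₃.symm,
        Equiv.swap_apply_of_ne_of_ne h₂.symm h₄.symm]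
    rwa [mul_inv_eq_iff_eq_mul] at this
  have hs' (a) : Equiv.swap x y (Equiv.swap z u a) = Equiv.swap z u (Equiv.swap x y a) :=
    Equiv.congr_fun hs a
  refine eq_of_intertwine (fun w => ?_) fun a b =>
    ⟨opL (E (Equiv.swap x y (Equiv.swap z u a)) (Equiv.swap x y (Equiv.swap z u b))), ?_⟩
  · simp only [end_mul_apply, opS_single_one, ← mul_assoc, hs]
  · have c₁ : coef x y (Equiv.swap z u a) (Equiv.swap z u b) = coef x y a b := by
      rw [← coef_map (Equiv.swap z u)]
      simp [Equiv.swap_apply_of_ne_of_ne h₁ h₂, Equiv.swap_apply_of_ne_of_ne h₃ h₄]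
    have c₂ : coef z u (Equiv.swap x y a) (Equiv.swap x y b) = coef z u a b := by
      rw [← coef_map (Equiv.swap x y)]
      simp [Equiv.swap_apply_of_ne_of_ne h₁.symm h₃.symm,
        Equiv.swap_apply_of_ne_of_ne h₂.symm h₄.symm]
    rw [sub_mul, mul_assoc, mul_assoc, opS_mul_opL, opS_mul_opL, mul_add, mul_add, ← mul_assoc,
      ← mul_assoc, opS_mul_opL, opS_mul_opL, c₁, c₂, hs', hs',
      ← (Int.cast_commute _ (opS hxy)).eq, ← (Int.cast_commute _ (opS hzu)).eq]
    simp only [add_mul, mul_sub, mul_assoc]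
    abel

lemma opS_opS_opS_opL {p q r s : α} (hpq : p ≠ q) (hrs : r ≠ s) (a b : α) :
    opS hpq * opS hrs * opS hpq * opL (E a b) =
      opL (E (Equiv.swap p q (Equiv.swap r s (Equiv.swap p q a)))
        (Equiv.swap p q (Equiv.swap r s (Equiv.swap p q b)))) * (opS hpq * opS hrs * opS hpq) +
      coef p q (Equiv.swap r s (Equiv.swap p q a)) (Equiv.swap r s (Equiv.swap p q b)) *
        (opS hrs * opS hpq) +
      coef r s (Equiv.swap p q a) (Equiv.swap p q b) +
      coef p q a b * (opS hpq * opS hrs) := by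
  have hS (k : ℤ) (T : AddMonoid.End (PairMod α)) : T * k = k * T :=
    (Int.cast_commute k T).eq.symm
  calc
    _ = opS hpq * (opS hrs * (opS hpq * opL (E a b))) := by simp only [mul_assoc]
    _ = opS hpq * (opS hrs * opL (E (Equiv.swap p q a) (Equiv.swap p q b))) * opS hpq +
        coef p q a b * (opS hpq * opS hrs) := by
      rw [opS_mul_opL, mul_add, mul_add, hS, ← mul_assoc _ _ (opS hrs), ← hS]
      simp only [mul_assoc, hS]
    _ = opS hpq * opL (E (Equiv.swap r s (Equiv.swap p q a))
          (Equiv.swap r s (Equiv.swap p q b))) * (opS hrs * opS hpq) +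
        coef r s (Equiv.swap p q a) (Equiv.swap p q b) +
        coef p q a b * (opS hpq * opS hrs) := by
      rw [opS_mul_opL, mul_add, hS, add_mul]
      simp only [mul_assoc, opS_sq, mul_one]
    _ = _ := by
      rw [opS_mul_opL, add_mul]
      simp only [mul_assoc]

lemma opS_braid {x y z : α} (hxy : x ≠ y) (hyz : y ≠ z) (hxz : x ≠ z) :
    opS hxy * opS hyz * opS hxy = opS hyz * opS hxy * opS hyz := by
  have hxy' := hxy.symm
  have hyz' := hyz.symm
  have hxz' := hxz.symm
  have hs' (a) : Equiv.swap x y (Equiv.swap y z (Equiv.swap x y a)) =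
      Equiv.swap y z (Equiv.swap x y (Equiv.swap y z a)) := by
    simp only [Equiv.swap_apply_def]; grind
  have hs : Equiv.swap x y * Equiv.swap y z * Equiv.swap x y =
      Equiv.swap y z * Equiv.swap x y * Equiv.swap y z := Equiv.ext hs'
  refine eq_of_intertwine (fun w => ?_) fun a b =>
    ⟨opL (E (Equiv.swap x y (Equiv.swap y z (Equiv.swap x y a)))
      (Equiv.swap x y (Equiv.swap y z (Equiv.swap x y b)))), ?_⟩
  · simp only [end_mul_apply, opS_single_one, ← mul_assoc, hs]
  · have h₁ : Equiv.swap x y z = z := Equiv.swap_apply_of_ne_of_ne hxz' hyz'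
    have h₂ : Equiv.swap y z x = x := Equiv.swap_apply_of_ne_of_ne hxy hxz
    have c₁ : coef x y (Equiv.swap y z (Equiv.swap x y a)) (Equiv.swap y z (Equiv.swap x y b)) =
        coef y z a b := by
      rw [← coef_map (Equiv.swap y z), ← coef_map (Equiv.swap x y)]
      simp [h₁, h₂]
    have c₂ : coef y z (Equiv.swap x y (Equiv.swap y z a)) (Equiv.swap x y (Equiv.swap y z b)) =
        coef x y a b := by
      rw [← coef_map (Equiv.swap x y), ← coef_map (Equiv.swap y z)]
      simp [h₁, h₂]
    have c₃ : coef y z (Equiv.swap x y a) (Equiv.swap x y b) =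
        coef x y (Equiv.swap y z a) (Equiv.swap y z b) := by
      rw [← coef_map (Equiv.swap x y), ← coef_map (Equiv.swap y z) x y]
      simp [h₁, h₂]
    rw [sub_mul, opS_opS_opS_opL, opS_opS_opS_opL, c₁, c₂, c₃, hs', hs', mul_sub]
    abel

lemma opS_mul_opL_of_ne {x y : α} (hxy : x ≠ y) {a b a' b' : α} (h₁ : ¬(a = y ∧ b = x))
    (h₂ : ¬(a = x ∧ b = y)) (ha : Equiv.swap x y a = a') (hb : Equiv.swap x y b = b') :
    opS hxy * opL (E a b) = opL (E a' b') * opS hxy := by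
  rw [opS_mul_opL, ha, hb, coef, if_neg h₁, if_neg h₂, Int.cast_zero, add_zero]

lemma opS_mul_opL_self {x y : α} (hxy : x ≠ y) :
    opS hxy * opL (E x y) = opS hxy - opL (E x y) * opS hxy - 1 := by
  rw [opS_mul_opL, Equiv.swap_apply_left, Equiv.swap_apply_right,
    ← sub_eq_of_eq_add' (E_add_E hxy).symm, map_sub, map_one, sub_mul, one_mul,
    coef, if_neg (fun h => hxy h.1), if_pos ⟨rfl, rfl⟩, Int.cast_neg, Int.cast_one,
    ← sub_eq_add_neg]

lemma opS_mul_opL_left {x y z : α} (hxy : x ≠ y) (hyz : y ≠ z) (hxz : x ≠ z) :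
    opS hxy * opL (E y z) = opL (E x z) * opS hxy :=
  opS_mul_opL_of_ne hxy (by grind) (by grind) (Equiv.swap_apply_right ..)
    (Equiv.swap_apply_of_ne_of_ne hxz.symm hyz.symm)

lemma opS_mul_opL_right {x y z : α} (hxy : x ≠ y) (hyz : y ≠ z) (hxz : x ≠ z) :
    opS hyz * opL (E x y) = opL (E x z) * opS hyz :=
  opS_mul_opL_of_ne hyz (by grind) (by grind) (Equiv.swap_apply_of_ne_of_ne hxy hxz)
    (Equiv.swap_apply_left ..)

lemma opS_mul_opL_left' {x y z : α} (hxy : x ≠ y) (hyz : y ≠ z) (hxz : x ≠ z) :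
    opS hxy * opL (E x z) = opL (E y z) * opS hxy :=
  opS_mul_opL_of_ne hxy (by grind) (by grind) (Equiv.swap_apply_left ..)
    (Equiv.swap_apply_of_ne_of_ne hxz.symm hyz.symm)

lemma opS_mul_opL_right' {x y z : α} (hxy : x ≠ y) (hyz : y ≠ z) (hxz : x ≠ z) :
    opS hyz * opL (E x z) = opL (E x y) * opS hyz :=
  opS_mul_opL_of_ne hyz (by grind) (by grind) (Equiv.swap_apply_of_ne_of_ne hxy hxz)
    (Equiv.swap_apply_right ..)

end PairAlg
lemma finA_ne_finB (n : ℕ) (i : Fin (n - 1)) : finA n i ≠ finB n i := by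
  simp [finA, finB]

/-- The action of the generators of `H(Sₙ)`. -/
noncomputable def actGen (n : ℕ) : Gen n → AddMonoid.End (PairMod (Fin n))
  | Gen.s i => opS (finA_ne_finB n i)
  | Gen.D i => opL (E (finA n i) (finB n i))

lemma actGen_rel {n : ℕ} {u v : F n} (h : Rel n u v) :
    FreeAlgebra.lift ℤ (actGen n) u = FreeAlgebra.lift ℤ (actGen n) v := by
  have dist {i j : Fin (n - 1)} (h : Dist n i j) : finA n i ≠ finA n j ∧ finA n i ≠ finB n j ∧
      finB n i ≠ finA n j ∧ finB n i ≠ finB n j := by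
    simp only [finA, finB, ne_eq, Fin.mk.injEq]
    unfold Dist at h
    omega
  have adj {i j : Fin (n - 1)} (h : (i : ℕ) + 1 = j) :
      ∃ x y z : Fin n, finA n i = x ∧ finB n i = y ∧ finA n j = y ∧ finB n j = z ∧
        x ≠ y ∧ y ≠ z ∧ x ≠ z := by
    refine ⟨_, _, _, rfl, rfl, ?_, rfl, ?_⟩ <;> simp [finA, finB] <;> omega
  cases h with
  | s_sq i => simp [fs, actGen, opS_sq]
  | sD i => simp [fs, fD, actGen, opS_mul_opL_self, sub_add_eq_add_sub]
  | D_sq i =>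
    simp only [fD, actGen, map_mul, FreeAlgebra.lift_ι_apply]
    rw [← map_mul, E_mul_self]
  | ss i j h =>
    obtain ⟨h₁, h₂, h₃, h₄⟩ := dist h
    simp [fs, actGen, opS_comm _ _ h₁ h₂ h₃ h₄]
  | Ds i j h =>
    obtain ⟨h₁, h₂, h₃, h₄⟩ := dist h
    simp only [fs, fD, actGen, map_mul, FreeAlgebra.lift_ι_apply]
    exact (opS_mul_opL_of_ne _ (fun h => h₃ h.1.symm) (fun h => h₁ h.1.symm)
      (Equiv.swap_apply_of_ne_of_ne h₁.symm h₃.symm)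
      (Equiv.swap_apply_of_ne_of_ne h₂.symm h₄.symm)).symm
  | DD i j h =>
    obtain ⟨h₁, h₂, h₃, h₄⟩ := dist h
    simp only [fD, actGen, map_mul, FreeAlgebra.lift_ι_apply]
    rw [← map_mul, ← map_mul, E_comm h₁ h₂ h₃ h₄]
  | braid i j h =>
    simp only [fs, actGen, map_mul, FreeAlgebra.lift_ι_apply]
    rcases h with h | h <;> obtain ⟨x, y, z, h₁, h₂, h₃, h₄, hxy, hyz, hxz⟩ := adj h <;>
      simp only [h₁, h₂, h₃, h₄]
    · exact (opS_braid hxy hyz hxz).symm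
    · exact opS_braid hxy hyz hxz
  | braidDs i j h =>
    simp only [fs, fD, actGen, map_mul, FreeAlgebra.lift_ι_apply]
    rcases h with h | h <;> obtain ⟨x, y, z, h₁, h₂, h₃, h₄, hxy, hyz, hxz⟩ := adj h <;>
      simp only [h₁, h₂, h₃, h₄]
    · rw [mul_assoc (opS hyz), opS_mul_opL_left hxy hyz hxz, ← mul_assoc,
        opS_mul_opL_right' hxy hyz hxz]
    · rw [mul_assoc (opS hxy), opS_mul_opL_right hxy hyz hxz, ← mul_assoc,
        opS_mul_opL_left' hxy hyz hxz]
  | braidDsD i j h =>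
    simp only [fs, fD, actGen, map_mul, map_add, FreeAlgebra.lift_ι_apply]
    rcases h with h | h <;> obtain ⟨x, y, z, h₁, h₂, h₃, h₄, hxy, hyz, hxz⟩ := adj h <;>
      simp only [h₁, h₂, h₃, h₄]
    · rw [mul_assoc, opS_mul_opL_left hxy hyz hxz, mul_assoc _ _ (opL (E x y)),
        mul_assoc _ (opS hxy) (opS hxy), opS_sq, opS_mul_opL_self, ← map_mul opL (E x y),
        E_mul_E hxy hyz hxz]
      simp only [map_sub, map_add, map_mul]
      noncomm_ring
    · rw [mul_assoc, opS_mul_opL_right hxy hyz hxz, mul_assoc _ _ (opL (E y z)),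
        mul_assoc _ (opS hyz) (opS hyz), opS_sq, opS_mul_opL_self, ← map_mul opL (E y z),
        E_mul_E' hxy hyz hxz]
      simp only [map_sub, map_add, map_mul]
      noncomm_ring

/-- The action of `H(Sₙ)` on `PairMod (Fin n)`. -/
noncomputable def act (n : ℕ) : HH n →ₐ[ℤ] AddMonoid.End (PairMod (Fin n)) :=
  RingQuot.liftAlgHom ℤ ⟨FreeAlgebra.lift ℤ (actGen n), fun _ _ h => actGen_rel h⟩

lemma act_sg (n : ℕ) (i : Fin (n - 1)) : act n (sg n i) = opS (finA_ne_finB n i) := by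
  simp [act, sg, fs, actGen]

lemma act_dg (n : ℕ) (i : Fin (n - 1)) : act n (dg n i) = opL (E (finA n i) (finB n i)) := by
  simp [act, dg, fD, actGen]

section Relations

variable (n : ℕ)

lemma sg_mul_self (i : Fin (n - 1)) : sg n i * sg n i = 1 := by
  simpa [sg] using RingQuot.mkAlgHom_rel ℤ (Rel.s_sq i)

lemma sg_mul_dg (i : Fin (n - 1)) : sg n i * dg n i = sg n i - 1 - dg n i * sg n i :=
  eq_sub_of_add_eq (by simpa [sg, dg] using RingQuot.mkAlgHom_rel ℤ (Rel.sD i))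

lemma dg_mul_self (i : Fin (n - 1)) : dg n i * dg n i = dg n i := by
  simpa [dg] using RingQuot.mkAlgHom_rel ℤ (Rel.D_sq i)

lemma dg_comm {i j : Fin (n - 1)} (h : Dist n i j) : dg n j * dg n i = dg n i * dg n j := by
  simpa [dg] using RingQuot.mkAlgHom_rel ℤ (Rel.DD i j h)

lemma dg_sg_dg {i j : Fin (n - 1)} (h : Adj n i j) :
    dg n j * sg n i * dg n j =
      sg n i * dg n j * dg n i + dg n i * dg n j * sg n i + sg n i * dg n j * sg n i := by
  simpa [sg, dg] using RingQuot.mkAlgHom_rel ℤ (Rel.braidDsD i j h)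

lemma HH.induction {P : HH n → Prop} (int : ∀ r : ℤ, P r) (s : ∀ i, P (sg n i))
    (d : ∀ i, P (dg n i)) (add : ∀ x y, P x → P y → P (x + y))
    (mul : ∀ x y, P x → P y → P (x * y)) (h : HH n) : P h := by
  obtain ⟨f, rfl⟩ := RingQuot.mkAlgHom_surjective ℤ (Rel n) h
  induction f using FreeAlgebra.induction with
  | grade0 r => simpa using int r
  | grade1 p =>
    cases p with
    | s i => exact s i
    | D i => exact d i
  | mul x y hx hy => simpa using mul _ _ hx hy
  | add x y hx hy => simpa using add _ _ hx hy

end Relations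

/-- A permutation with prescribed values on an initial segment. -/
lemma exists_perm_extending {k n : ℕ} (h : k ≤ n) (f : Fin k → Fin n) (hf : f.Injective) :
    ∃ w : Equiv.Perm (Fin n), ∀ i, w (Fin.castLE h i) = f i := by
  obtain ⟨g, hg⟩ := (Equiv.Perm.isMultiplyPretransitive (Fin n) k).exists_smul_eq
    (Fin.castLEEmb h) ⟨f, hf⟩
  exact ⟨g, fun i => DFunLike.congr_fun hg i⟩

/-- `(π, Dij)` is a canonical homomorphism together with an equivariant family extending the
generators `D_i`. -/
structure IsFamily {n : ℕ} (π : Equiv.Perm (Fin n) →* (HH n)ˣ) (Dij : PairLT n → HH n) : Prop where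
  swap (i : Fin (n - 1)) : (π (Equiv.swap (finA n i) (finB n i)) : HH n) = sg n i
  simple (i : Fin (n - 1)) : Dij (pairOf n i) = dg n i
  conj (w : Equiv.Perm (Fin n)) (p : PairLT n) (h : w p.1.1 < w p.1.2) :
    (π w : HH n) * Dij p * (((π w)⁻¹ : (HH n)ˣ) : HH n) = Dij ⟨(w p.1.1, w p.1.2), h⟩

/-- The family `D_{ij}`, extended to all pairs by `D_{ji} = 1 - D_{ij}` and `D_{ii} = 0`. -/
noncomputable def elt {n : ℕ} (Dij : PairLT n → HH n) (a b : Fin n) : HH n :=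
  if h : a < b then Dij ⟨(a, b), h⟩ else if h : b < a then 1 - Dij ⟨(b, a), h⟩ else 0

section Elt

variable {n : ℕ} {π : Equiv.Perm (Fin n) →* (HH n)ˣ} {Dij : PairLT n → HH n}

lemma elt_of_lt {a b : Fin n} (h : a < b) : elt Dij a b = Dij ⟨(a, b), h⟩ := dif_pos h

lemma elt_self (a : Fin n) : elt Dij a a = 0 := by simp [elt]

lemma elt_symm {a b : Fin n} (h : a ≠ b) : elt Dij b a = 1 - elt Dij a b := by
  rcases lt_or_gt_of_ne h with h | h <;> simp [elt, h, h.not_gt]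

lemma elt_simple (H : IsFamily π Dij) (i : Fin (n - 1)) :
    elt Dij (finA n i) (finB n i) = dg n i := by
  rw [← H.simple, elt_of_lt]; rfl

lemma smul_elt (H : IsFamily π Dij) (w : Equiv.Perm (Fin n)) {a b : Fin n} (h : a < b)
    (h' : w a < w b) : ConjAct.toConjAct (π w) • elt Dij a b = elt Dij (w a) (w b) := by
  rw [elt_of_lt h, elt_of_lt h', ← H.conj w ⟨(a, b), h⟩ h', ConjAct.units_smul_def,
    ConjAct.ofConjAct_toConjAct]

lemma sg_mul_elt (H : IsFamily π Dij) (i : Fin (n - 1)) (a b : Fin n) :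
    sg n i * elt Dij a b =
      elt Dij (Equiv.swap (finA n i) (finB n i) a) (Equiv.swap (finA n i) (finB n i) b) * sg n i +
        coef (finA n i) (finB n i) a b := by
  have lt : ∀ {a b : Fin n}, a < b → sg n i * elt Dij a b =
      elt Dij (Equiv.swap (finA n i) (finB n i) a) (Equiv.swap (finA n i) (finB n i) b) * sg n i +
        coef (finA n i) (finB n i) a b := by
    intro a b hab
    by_cases h : a = finA n i ∧ b = finB n i
    · obtain ⟨rfl, rfl⟩ := h
      rw [Equiv.swap_apply_left, Equiv.swap_apply_right, elt_symm hab.ne, elt_simple H, sg_mul_dg,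
        coef, if_neg (fun h => hab.ne h.1), if_pos ⟨rfl, rfl⟩]
      simp only [Int.cast_neg, Int.cast_one, sub_mul, one_mul]
      abel
    · have hc : coef (finA n i) (finB n i) a b = 0 := by
        rw [coef, if_neg, if_neg h]
        rintro ⟨rfl, rfl⟩
        simp [finA, finB, Fin.lt_def] at hab
      have hlt : Equiv.swap (finA n i) (finB n i) a < Equiv.swap (finA n i) (finB n i) b := by
        simp only [Equiv.swap_apply_def]
        simp only [finA, finB, Fin.lt_def, Fin.ext_iff] at *
        split_ifs <;> simp <;> omega
      have := smul_elt H _ hab hlt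
      rw [← this, ConjAct.units_smul_def, ConjAct.ofConjAct_toConjAct, hc, ← H.swap]
      simp
  rcases lt_trichotomy a b with h | rfl | h
  · exact lt h
  · have : coef (finA n i) (finB n i) a a = 0 := by
      have := finA_ne_finB n i
      unfold coef; grind
    simp [elt_self, this]
  · have hc : coef (finA n i) (finB n i) a b = -coef (finA n i) (finB n i) b a := by
      have := finA_ne_finB n i
      unfold coef; grind
    rw [elt_symm h.ne, elt_symm (a := Equiv.swap _ _ b) (by simpa using h.ne), mul_sub, lt h, hc]
    simp only [Int.cast_neg, sub_mul, one_mul, mul_one]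
    abel

lemma elt_mul_self (H : IsFamily π Dij) (a b : Fin n) :
    elt Dij a b * elt Dij a b = elt Dij a b := by
  have lt : ∀ {a b : Fin n}, a < b → elt Dij a b * elt Dij a b = elt Dij a b := by
    intro a b hab
    have hn : 2 ≤ n := by omega
    obtain ⟨w, hw⟩ := exists_perm_extending hn ![a, b] (by
      intro i j; fin_cases i <;> fin_cases j <;> simp [hab.ne, hab.ne'])
    have h₀ : w (finA n ⟨0, by omega⟩) = a := hw 0
    have h₁ : w (finB n ⟨0, by omega⟩) = b := hw 1
    have := smul_elt H w (a := finA n ⟨0, by omega⟩) (b := finB n ⟨0, by omega⟩)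
      (by simp [finA, finB, Fin.lt_def]) (by rwa [h₀, h₁])
    rw [h₀, h₁] at this
    rw [← this, ← smul_mul', elt_simple H, dg_mul_self]
  rcases lt_trichotomy a b with h | rfl | h
  · exact lt h
  · simp [elt_self]
  · have := lt h
    simp [elt_symm h.ne, mul_sub, sub_mul, this]

lemma elt_comm (H : IsFamily π Dij) {a b c d : Fin n} (hac : a ≠ c) (had : a ≠ d) (hbc : b ≠ c)
    (hbd : b ≠ d) : Commute (elt Dij a b) (elt Dij c d) := by
  have lt : ∀ {a b c d : Fin n}, a < b → c < d → a ≠ c → a ≠ d → b ≠ c → b ≠ d →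
      Commute (elt Dij a b) (elt Dij c d) := by
    intro a b c d hab hcd hac had hbc hbd
    have hf : Function.Injective ![a, b, c, d] := by
      intro i j
      fin_cases i <;> fin_cases j <;>
        simp [hab.ne, hab.ne', hcd.ne, hcd.ne', hac, had, hbc, hbd, hac.symm, had.symm, hbc.symm,
          hbd.symm]
    have hn : 4 ≤ n := by simpa using Fintype.card_le_of_injective _ hf
    obtain ⟨w, hw⟩ := exists_perm_extending hn _ hf
    have h₀ : w (finA n ⟨0, by omega⟩) = a := hw 0
    have h₁ : w (finB n ⟨0, by omega⟩) = b := hw 1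
    have h₂ : w (finA n ⟨2, by omega⟩) = c := hw 2
    have h₃ : w (finB n ⟨2, by omega⟩) = d := hw 3
    have e₁ := smul_elt H w (a := finA n ⟨0, by omega⟩) (b := finB n ⟨0, by omega⟩)
      (by simp [finA, finB, Fin.lt_def]) (by rwa [h₀, h₁])
    have e₂ := smul_elt H w (a := finA n ⟨2, by omega⟩) (b := finB n ⟨2, by omega⟩)
      (by simp [finA, finB, Fin.lt_def]) (by rwa [h₂, h₃])
    rw [h₀, h₁] at e₁
    rw [h₂, h₃] at e₂
    rw [← e₁, ← e₂, elt_simple H, elt_simple H, Commute, SemiconjBy, ← smul_mul', ← smul_mul',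
      dg_comm]
    right; simp
  have lt' : ∀ {a b c d : Fin n}, a < b → a ≠ c → a ≠ d → b ≠ c → b ≠ d →
      Commute (elt Dij a b) (elt Dij c d) := by
    intro a b c d hab hac had hbc hbd
    rcases lt_trichotomy c d with h | rfl | h
    · exact lt hab h hac had hbc hbd
    · rw [elt_self]; exact Commute.zero_right _
    · rw [elt_symm h.ne]
      exact (Commute.one_right _).sub_right (lt hab h had hac hbd hbc)
  rcases lt_trichotomy a b with h | rfl | h
  · exact lt' h hac had hbc hbd
  · rw [elt_self]; exact Commute.zero_left _
  · rw [elt_symm h.ne]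
    exact (Commute.one_left _).sub_left (lt' h hbc hbd hac had)

lemma elt_mul_elt_simple (H : IsFamily π Dij) {i j : Fin (n - 1)} (h : (i : ℕ) + 1 = j) :
    dg n i * dg n j = elt Dij (finA n i) (finB n j) * dg n i +
        dg n j * elt Dij (finA n i) (finB n j) - elt Dij (finA n i) (finB n j) ∧
      dg n j * dg n i = dg n i * elt Dij (finA n i) (finB n j) +
        elt Dij (finA n i) (finB n j) * dg n j - elt Dij (finA n i) (finB n j) := by
  obtain ⟨x, y, z, h₁, h₂, h₃, h₄, hxy, hyz, hxz⟩ : ∃ x y z : Fin n, finA n i = x ∧ finB n i = y ∧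
      finA n j = y ∧ finB n j = z ∧ x ≠ y ∧ y ≠ z ∧ x ≠ z := by
    refine ⟨_, _, _, rfl, rfl, ?_, rfl, ?_⟩ <;> simp [finA, finB] <;> omega
  have ei := elt_simple H i
  have ej := elt_simple H j
  have a₁ := sg_mul_elt H i y z
  have a₂ := sg_mul_elt H i x z
  have b₁ := sg_mul_elt H j x y
  have b₂ := sg_mul_elt H j x z
  simp only [h₁, h₂, h₃, h₄, Equiv.swap_apply_left, Equiv.swap_apply_right,
    Equiv.swap_apply_of_ne_of_ne hxz.symm hyz.symm, Equiv.swap_apply_of_ne_of_ne hxy hxz, coef,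
    hxy, hyz, hxz, hxy.symm, hyz.symm, hxz.symm, and_false, false_and, if_false, Int.cast_zero,
    add_zero] at ei ej a₁ a₂ b₁ b₂ ⊢
  have r₁ := dg_sg_dg n (Or.inl h : Adj n i j)
  have r₂ := dg_sg_dg n (Or.inr h : Adj n j i)
  have si := sg_mul_self n i
  have sj := sg_mul_self n j
  have di := sg_mul_dg n i
  have dj := sg_mul_dg n j
  rw [ei] at b₁
  rw [ej] at a₁
  rw [ej] at a₂
  rw [ei] at b₂
  generalize elt Dij x z = e at *
  have cancel {s u v : HH n} (hs : s * s = 1) (h : u * s = v * s) : u = v := by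
    rw [← mul_one u, ← hs, ← mul_assoc, h, mul_assoc, hs, mul_one]
  constructor
  · refine cancel si ?_
    rw [mul_assoc, a₁, mul_assoc, di, mul_assoc e, si] at r₁
    rw [sub_mul, add_mul, mul_assoc (dg n j), r₁]
    simp only [mul_sub, mul_one, mul_assoc]
    abel
  · refine cancel sj ?_
    rw [mul_assoc, b₁, mul_assoc, dj, mul_assoc e, sj] at r₂
    rw [sub_mul, add_mul, mul_assoc (dg n i), r₂]
    simp only [mul_sub, mul_one, mul_assoc]
    abel

lemma elt_mul_elt (H : IsFamily π Dij) {a b c : Fin n} (hab : a < b) (hbc : b < c) :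
    elt Dij a b * elt Dij b c =
        elt Dij a c * elt Dij a b + elt Dij b c * elt Dij a c - elt Dij a c ∧
      elt Dij b c * elt Dij a b =
        elt Dij a b * elt Dij a c + elt Dij a c * elt Dij b c - elt Dij a c := by
  have hac := hab.trans hbc
  have hn : 3 ≤ n := by omega
  obtain ⟨w, hw⟩ := exists_perm_extending hn ![a, b, c] (by
    intro i j
    fin_cases i <;> fin_cases j <;> simp [hab.ne, hab.ne', hbc.ne, hbc.ne', hac.ne, hac.ne'])
  have h₀ : w (finA n ⟨0, by omega⟩) = a := hw 0
  have h₁ : w (finB n ⟨0, by omega⟩) = b := hw 1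
  have h₁' : w (finA n ⟨1, by omega⟩) = b := hw 1
  have h₂ : w (finB n ⟨1, by omega⟩) = c := hw 2
  have e₁ := smul_elt H w (a := finA n ⟨0, by omega⟩) (b := finB n ⟨0, by omega⟩)
    (by simp [finA, finB, Fin.lt_def]) (by rwa [h₀, h₁])
  have e₂ := smul_elt H w (a := finA n ⟨1, by omega⟩) (b := finB n ⟨1, by omega⟩)
    (by simp [finA, finB, Fin.lt_def]) (by rwa [h₁', h₂])
  have e₃ := smul_elt H w (a := finA n ⟨0, by omega⟩) (b := finB n ⟨1, by omega⟩)
    (by simp [finA, finB, Fin.lt_def]) (by rwa [h₀, h₂])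
  rw [h₀, h₁] at e₁
  rw [h₁', h₂] at e₂
  rw [h₀, h₂] at e₃
  have key := elt_mul_elt_simple H (i := ⟨0, by omega⟩) (j := ⟨1, by omega⟩) rfl
  rw [← e₁, ← e₂, ← e₃, elt_simple H, elt_simple H]
  simp only [← smul_mul', ← smul_add, ← smul_sub]
  exact ⟨congrArg _ key.1, congrArg _ key.2⟩

lemma elt_cyc (H : IsFamily π Dij) {a b c : Fin n} (hab : a ≠ b) (hbc : b ≠ c) (hac : a ≠ c) :
    elt Dij a b * elt Dij b c + elt Dij b c * elt Dij c a + elt Dij c a * elt Dij a b =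
      elt Dij a b + elt Dij b c + elt Dij c a - 1 := by
  have min : ∀ {a b c : Fin n}, a < b → a < c → b ≠ c →
      elt Dij a b * elt Dij b c + elt Dij b c * elt Dij c a + elt Dij c a * elt Dij a b =
        elt Dij a b + elt Dij b c + elt Dij c a - 1 := by
    intro a b c hab hac hbc
    rcases lt_or_gt_of_ne hbc with h | h
    · rw [elt_symm hac.ne, (elt_mul_elt H hab h).1]
      simp only [mul_sub, sub_mul, mul_one, one_mul]
      abel
    · have := (elt_mul_elt H hac h).2
      rw [elt_symm hac.ne, elt_symm h.ne]
      simp only [mul_sub, sub_mul, mul_one, one_mul, this]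
      abel
  rcases lt_or_gt_of_ne hab with h₁ | h₁
  · rcases lt_or_gt_of_ne hac with h₂ | h₂
    · exact min h₁ h₂ hbc
    · have := min h₂ (h₂.trans h₁) hab
      rw [← sub_eq_zero] at this ⊢
      rw [← this]
      abel
  · rcases lt_or_gt_of_ne hbc with h₂ | h₂
    · have := min h₂ h₁ hac.symm
      rw [← sub_eq_zero] at this ⊢
      rw [← this]
      abel
    · have := min (h₂.trans h₁) h₂ hab
      rw [← sub_eq_zero] at this ⊢
      rw [← this]
      abel

end Elt

section Factorization

variable {n : ℕ} {π : Equiv.Perm (Fin n) →* (HH n)ˣ} {Dij : PairLT n → HH n}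

/-- The homomorphism `PairAlg (Fin n) → H(Sₙ)` sending `E_{ij}` to `D_{ij}` for `i < j`. -/
noncomputable def psi (H : IsFamily π Dij) : PairAlg (Fin n) →+* HH n :=
  pairLift (elt Dij) elt_self (fun _ _ h => by rw [elt_symm h, add_sub_cancel]) (elt_mul_self H)
    (fun _ _ _ _ h₁ h₂ h₃ h₄ => elt_comm H h₁ h₂ h₃ h₄) (fun _ _ _ h₁ h₂ h₃ => elt_cyc H h₁ h₂ h₃)

lemma psi_E (H : IsFamily π Dij) (a b : Fin n) : psi H (E a b) = elt Dij a b :=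
  pairLift_E ..

lemma sg_mul_psi (H : IsFamily π Dij) (i : Fin (n - 1)) (d : PairAlg (Fin n)) :
    sg n i * psi H d =
      psi H (sigma (finA_ne_finB n i) d) * sg n i + psi H (del (finA_ne_finB n i) d) := by
  induction d using PairAlg.induction with
  | int r => simp [sigma_intCast, del_intCast, (Int.cast_commute r (sg n i)).eq]
  | gen a b => rw [sigma_E, del_E, psi_E, psi_E, map_intCast, sg_mul_elt H]
  | add d e hd he =>
    simp only [map_add, mul_add, add_mul, hd, he]
    abel
  | mul d e hd he =>
    rw [map_mul, ← mul_assoc, hd, add_mul, mul_assoc, he, sigma_mul, del_mul]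
    simp only [map_add, map_mul, mul_add, mul_assoc, add_assoc]

/-- The map `PairMod (Fin n) → H(Sₙ)` sending `d ⊗ w` to `psi d * π w`. -/
noncomputable def mulMap (H : IsFamily π Dij) : PairMod (Fin n) →+ HH n :=
  liftMod fun w => (AddMonoidHom.mulRight (π w : HH n)).comp (psi H).toAddMonoidHom

lemma mulMap_basisElt (H : IsFamily π Dij) (w : Equiv.Perm (Fin n)) (d : PairAlg (Fin n)) :
    mulMap H (basisElt w d) = psi H d * π w :=
  liftMod_basisElt ..

lemma mulMap_opL (H : IsFamily π Dij) (d : PairAlg (Fin n)) (m : PairMod (Fin n)) :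
    mulMap H (opL d m) = psi H d * mulMap H m := by
  have : (mulMap H).comp (opL d) = (AddMonoidHom.mulLeft (psi H d)).comp (mulMap H) :=
    PairMod.hom_ext fun w e => by
      change mulMap H (opL d _) = psi H d * mulMap H _
      rw [opL_single, mulMap_basisElt, mulMap_basisElt, map_mul, mul_assoc]
  exact DFunLike.congr_fun this m

lemma mulMap_opS (H : IsFamily π Dij) (i : Fin (n - 1)) (m : PairMod (Fin n)) :
    mulMap H (opS (finA_ne_finB n i) m) = sg n i * mulMap H m := by
  have : (mulMap H).comp (opS (finA_ne_finB n i)) =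
      (AddMonoidHom.mulLeft (sg n i)).comp (mulMap H) :=
    PairMod.hom_ext fun w d => by
      change mulMap H (opS _ _) = sg n i * mulMap H _
      rw [opS_single, map_add, mulMap_basisElt, mulMap_basisElt, mulMap_basisElt, ← mul_assoc,
        sg_mul_psi H, map_mul, Units.val_mul, H.swap, add_mul, mul_assoc]
  exact DFunLike.congr_fun this m

lemma mulMap_act (H : IsFamily π Dij) (h : HH n) (m : PairMod (Fin n)) :
    mulMap H (act n h m) = h * mulMap H m := by
  induction h using HH.induction generalizing m with
  | int r => rw [map_intCast, AddMonoid.End.intCast_apply, map_zsmul, zsmul_eq_mul]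
  | s i => rw [act_sg, mulMap_opS]
  | d i => rw [act_dg, mulMap_opL, psi_E, elt_simple H]
  | add x y hx hy => rw [map_add, end_add_apply, map_add, hx, hy, add_mul]
  | mul x y hx hy => rw [map_mul, end_mul_apply, hx, hy, mul_assoc]

lemma act_elt (H : IsFamily π Dij) (a b : Fin n) : act n (elt Dij a b) = opL (E a b) := by
  have lt (k : ℕ) : ∀ a b : Fin n, (a : ℕ) + k + 1 = b → act n (elt Dij a b) = opL (E a b) := by
    induction k with
    | zero =>
      intro a b h
      obtain ⟨i, rfl, rfl⟩ : ∃ i, finA n i = a ∧ finB n i = b :=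
        ⟨⟨a, by omega⟩, rfl, Fin.ext h⟩
      rw [elt_simple H, act_dg]
    | succ k ih =>
      intro a b h
      obtain ⟨i, hai, rfl⟩ : ∃ i, (a : ℕ) + k + 1 = finA n i ∧ finB n i = b :=
        ⟨⟨a + k + 1, by omega⟩, rfl, Fin.ext h⟩
      have h₁ : a ≠ finA n i := by intro h; rw [← h] at hai; omega
      have h₂ : a ≠ finB n i := by intro h'; rw [← h'] at h; omega
      have hs : Equiv.swap (finA n i) (finB n i) a = a := Equiv.swap_apply_of_ne_of_ne h₁ h₂
      have hc : coef (finA n i) (finB n i) a (finA n i) = 0 := by simp [coef, h₁, h₂]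
      have e := congrArg (act n) (sg_mul_elt H i a (finA n i))
      rw [hc, hs, Equiv.swap_apply_left, Int.cast_zero, add_zero, map_mul, map_mul, act_sg,
        ih _ _ hai, opS_mul_opL_of_ne _ (fun h => h₂ h.1) (fun h => h₁ h.1) hs
          (Equiv.swap_apply_left ..)] at e
      have := congrArg (· * opS (finA_ne_finB n i)) e
      simpa only [mul_assoc, opS_sq, mul_one] using this.symm
  have lt' {a b : Fin n} (h : a < b) := lt (b - a - 1) a b (by omega)
  rcases lt_trichotomy a b with h | rfl | h
  · exact lt' h
  · rw [elt_self, E_self, map_zero, map_zero]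
  · rw [elt_symm h.ne, map_sub, lt' h, map_one, ← map_one opL, ← map_sub,
      sub_eq_of_eq_add' (E_add_E h.ne).symm]

lemma act_psi (H : IsFamily π Dij) (d : PairAlg (Fin n)) : act n (psi H d) = opL d := by
  induction d using PairAlg.induction with
  | int r => simp
  | gen a b => rw [psi_E, act_elt H]
  | add d e hd he => simp only [map_add, hd, he]
  | mul d e hd he => simp only [map_mul, hd, he]

lemma act_perm (H : IsFamily π Dij) (w v : Equiv.Perm (Fin n)) :
    act n (π w) (basisElt v 1) = basisElt (w * v) 1 := by
  obtain _ | m := n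
  · rw [Subsingleton.elim w 1, map_one, Units.val_one, map_one, one_mul]
    rfl
  have hw : w ∈ Submonoid.closure
      (Set.range fun i : Fin m => Equiv.swap i.castSucc i.succ) := by
    rw [Equiv.Perm.mclosure_swap_castSucc_succ]
    trivial
  induction hw using Submonoid.closure_induction generalizing v with
  | mem w hw =>
    obtain ⟨i, rfl⟩ := hw
    exact ((congrArg (fun x => act _ x (basisElt v 1)) (H.swap i)).trans
      (congrArg (· (basisElt v 1)) (act_sg (m + 1) i))).trans (opS_single_one ..)
  | one =>
    rw [map_one, Units.val_one, map_one, one_mul]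
    rfl
  | mul x y _ _ hx hy =>
    rw [map_mul, Units.val_mul, map_mul, end_mul_apply, hy, hx, mul_assoc]

lemma act_mulMap (H : IsFamily π Dij) (m : PairMod (Fin n)) :
    act n (mulMap H m) (basisElt 1 1) = m := by
  have : ((AddMonoidHom.eval (basisElt 1 1)).comp (act n).toRingHom.toAddMonoidHom).comp
      (mulMap H) = AddMonoidHom.id _ :=
    PairMod.hom_ext fun w d => by
      change act n (mulMap H _) (basisElt 1 1) = basisElt w d
      rw [mulMap_basisElt, map_mul, end_mul_apply, act_perm H, act_psi, opL_single, mul_one,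
        mul_one]
  exact DFunLike.congr_fun this m

lemma mulMap_bijective (H : IsFamily π Dij) : Function.Bijective (mulMap H) := by
  refine ⟨fun x y h => ?_, fun h => ⟨act n h (basisElt 1 1), ?_⟩⟩
  · rw [← act_mulMap H x, h, act_mulMap]
  · simp [mulMap_act, mulMap_basisElt]

lemma psi_mem_adjoin (H : IsFamily π Dij) (d : PairAlg (Fin n)) :
    psi H d ∈ Algebra.adjoin ℤ (Set.range Dij) := by
  induction d using PairAlg.induction with
  | int r => rw [map_intCast]; exact intCast_mem _ r
  | gen a b =>
    rw [psi_E, elt]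
    split_ifs
    · exact Algebra.subset_adjoin ⟨_, rfl⟩
    · exact sub_mem (one_mem _) (Algebra.subset_adjoin ⟨_, rfl⟩)
    · exact zero_mem _
  | add d e hd he => rw [map_add]; exact add_mem hd he
  | mul d e hd he => rw [map_mul]; exact mul_mem hd he

lemma exists_psi_eq (H : IsFamily π Dij) {x : HH n} (hx : x ∈ Algebra.adjoin ℤ (Set.range Dij)) :
    ∃ d, psi H d = x := by
  induction hx using Algebra.adjoin_induction with
  | mem x hx =>
    obtain ⟨p, rfl⟩ := hx
    exact ⟨E p.1.1 p.1.2, by rw [psi_E, elt_of_lt p.2]; rfl⟩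
  | algebraMap r => exact ⟨r, by simp⟩
  | add x y _ _ hx hy =>
    obtain ⟨d, rfl⟩ := hx
    obtain ⟨e, rfl⟩ := hy
    exact ⟨d + e, map_add ..⟩
  | mul x y _ _ hx hy =>
    obtain ⟨d, rfl⟩ := hx
    obtain ⟨e, rfl⟩ := hy
    exact ⟨d * e, map_mul ..⟩

/-- The map `PairMod (Fin n) → D(Sₙ) ⊗ ℤ[Sₙ]` sending `d ⊗ w` to `psi d ⊗ w`. -/
noncomputable def toTensor (H : IsFamily π Dij) :
    PairMod (Fin n) →+ (Algebra.adjoin ℤ (Set.range Dij)) ⊗[ℤ]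
      (MonoidAlgebra ℤ (Equiv.Perm (Fin n))) :=
  liftMod fun w =>
    ((TensorProduct.mk ℤ _ _).flip (MonoidAlgebra.of ℤ (Equiv.Perm (Fin n)) w)).toAddMonoidHom.comp
      ((psi H).codRestrict (Algebra.adjoin ℤ (Set.range Dij)) (psi_mem_adjoin H)).toAddMonoidHom

lemma toTensor_basisElt (H : IsFamily π Dij) (w : Equiv.Perm (Fin n)) (d : PairAlg (Fin n)) :
    toTensor H (basisElt w d) =
      (⟨psi H d, psi_mem_adjoin H d⟩ : Algebra.adjoin ℤ (Set.range Dij)) ⊗ₜ[ℤ]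
        MonoidAlgebra.of ℤ (Equiv.Perm (Fin n)) w :=
  liftMod_basisElt ..

lemma toTensor_surjective (H : IsFamily π Dij) : Function.Surjective (toTensor H) := by
  intro t
  change t ∈ AddMonoidHom.mrange (toTensor H)
  induction t with
  | zero => exact zero_mem _
  | add x y hx hy => exact add_mem hx hy
  | tmul x f =>
    induction f using MonoidAlgebra.induction_on generalizing x with
    | of w =>
      obtain ⟨d, hd⟩ := exists_psi_eq H x.2
      refine ⟨basisElt w d, ?_⟩
      rw [toTensor_basisElt]
      congr 1
      exact Subtype.ext hd
    | add f g hf hg => rw [TensorProduct.tmul_add]; exact add_mem (hf x) (hg x)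
    | smul r f hf => rw [← TensorProduct.smul_tmul]; exact hf _

end Factorization

/-- For every `n ≥ 2`, `H(Sₙ)` factors as `D(Sₙ)·ℤSₙ`: the `ℤ`-linear map
`D(Sₙ) ⊗_ℤ ℤ[Sₙ] → H(Sₙ)`, `d ⊗ w ↦ d·π(w)`, is bijective.  Here `π : Sₙ → H(Sₙ)ˣ` is the
canonical homomorphism with `π(sᵢ) = sᵢ`, `(D_{ij})` is a family as in Proposition 4 and
`D(Sₙ)` is the `ℤ`-subalgebra generated by the `D_{ij}`. -/
theorem HH_factorization (n : ℕ) (hn : 2 ≤ n)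
    (π : Equiv.Perm (Fin n) →* (HH n)ˣ)
    (hπ : ∀ i : Fin (n - 1),
      ((π (Equiv.swap (finA n i) (finB n i)) : (HH n)ˣ) : HH n) = sg n i)
    (Dij : PairLT n → HH n)
    (hD1 : ∀ i : Fin (n - 1), Dij (pairOf n i) = dg n i)
    (hD2 : ∀ (w : Equiv.Perm (Fin n)) (p : PairLT n) (h : w p.1.1 < w p.1.2),
      ((π w : (HH n)ˣ) : HH n) * Dij p * (((π w)⁻¹ : (HH n)ˣ) : HH n) =
        Dij ⟨(w p.1.1, w p.1.2), h⟩) :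
    ∃ μ : (Algebra.adjoin ℤ (Set.range Dij)) ⊗[ℤ]
        (MonoidAlgebra ℤ (Equiv.Perm (Fin n))) →ₗ[ℤ] HH n,
      (∀ (d : Algebra.adjoin ℤ (Set.range Dij)) (w : Equiv.Perm (Fin n)),
        μ (d ⊗ₜ[ℤ] (MonoidAlgebra.of ℤ (Equiv.Perm (Fin n)) w)) =
          (d : HH n) * ((π w : (HH n)ˣ) : HH n)) ∧
      Function.Bijective μ := by
  have H : IsFamily π Dij := ⟨hπ, hD1, hD2⟩
  let μ : (Algebra.adjoin ℤ (Set.range Dij)) ⊗[ℤ] (MonoidAlgebra ℤ (Equiv.Perm (Fin n))) →ₗ[ℤ]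
      HH n :=
    LinearMap.mul' ℤ (HH n) ∘ₗ TensorProduct.map (Algebra.adjoin ℤ (Set.range Dij)).val.toLinearMap
      (MonoidAlgebra.lift ℤ (HH n) _ ((Units.coeHom (HH n)).comp π)).toLinearMap
  have hμ (d : Algebra.adjoin ℤ (Set.range Dij)) (w : Equiv.Perm (Fin n)) :
      μ (d ⊗ₜ[ℤ] (MonoidAlgebra.of ℤ (Equiv.Perm (Fin n)) w)) = (d : HH n) * (π w : HH n) := by
    refine (congrArg ((d : HH n) * ·) (MonoidAlgebra.lift_of ..)).trans ?_
    rfl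
  have comp : ⇑μ ∘ toTensor H = mulMap H := by
    have : μ.toAddMonoidHom.comp (toTensor H) = mulMap H :=
      PairMod.hom_ext fun w d => by
        change μ (toTensor H _) = _
        rw [toTensor_basisElt, hμ, mulMap_basisElt]
    exact congrArg DFunLike.coe this
  have hbij := mulMap_bijective H
  rw [← comp] at hbij
  exact ⟨μ, hμ, hbij.1.of_comp_right (toTensor_surjective H), hbij.2.of_comp⟩

end HeckeHopfSn
end
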